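/- For positive integers l and k with k ≤ 2l + 1, one has C_{l,k} = 1. -/

import Mathlib

open Filter Topology Set

/-- A numerical set: a cofinite subset of ℕ containing 0, not all of ℕ. -/
def IsNumericalSet (T : Set ℕ) : Prop :=
  0 ∈ T ∧ Tᶜ.Finite ∧ Tᶜ.Nonempty

/-- A numerical semigroup: a numerical set closed under addition. -/
def IsNumericalSemigroup (S : Set ℕ) : Prop :=
  IsNumericalSet S ∧ ∀ a ∈ S, ∀ b ∈ S, a + b ∈ S

/-- Frobenius number: the largest element of the complement. -/
noncomputable def frob (T : Set ℕ) : ℕ := sSup Tᶜ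

/-- The associated semigroup `A(T) = {t | t + T ⊆ T}`. -/
def AT (T : Set ℕ) : Set ℕ := {t : ℕ | ∀ x ∈ T, t + x ∈ T}

/-- Multiplicity: the smallest positive element. -/
noncomputable def mult (S : Set ℕ) : ℕ := sInf {x | x ∈ S ∧ 0 < x}

/-- `R(S) = f(S) - m(S)` as an integer. -/
noncomputable def RVal (S : Set ℕ) : ℤ := (frob S : ℤ) - (mult S : ℤ)

/-- `P(S)`: the number of numerical sets whose associated semigroup is `S`. -/
noncomputable def PCount (S : Set ℕ) : ℕ :=
  {T : Set ℕ | IsNumericalSet T ∧ AT T = S}.ncard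

/-- The density `μ(S) = P(S) / 2^(f(S)-1)`. -/
noncomputable def density (S : Set ℕ) : ℝ :=
  (PCount S : ℝ) / 2 ^ (frob S - 1)

/-- The numerical semigroup `N(D,f) = {0} ∪ {f - l : l ∈ D} ∪ (f, ∞)`. -/
def NSet (D : Finset ℕ) (f : ℕ) : Set ℕ :=
  {0} ∪ (fun l => f - l) '' (D : Set ℕ) ∪ {x | f < x}

/-- `B(D,f)`: numerical sets `T` with `f(T) = f` and
`A(T) ∩ [f - Max D, f - 1] = {f - l : l ∈ D}`. -/
def BSet (D : Finset ℕ) (f : ℕ) : Set (Set ℕ) :=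
  {T | IsNumericalSet T ∧ frob T = f ∧
    AT T ∩ Set.Icc (f - D.sup id) (f - 1) = (fun l => f - l) '' (D : Set ℕ)}

/-- `A_D = |B(D, 2 Max D + 1)|`. -/
noncomputable def AConst (D : Finset ℕ) : ℕ :=
  (BSet D (2 * D.sup id + 1)).ncard

/-- `B_l(k,f) = {T ∈ B({k},f) : T ∩ [1,l] = ∅}`. -/
def BlSet (l k f : ℕ) : Set (Set ℕ) :=
  {T | T ∈ BSet {k} f ∧ T ∩ Set.Icc 1 l = ∅}

/-- `C_{l,k}`. -/
noncomputable def CConst (l k : ℕ) : ℕ :=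
  if l ≤ k then (BlSet l k (2 * k + 1)).ncard else (BlSet l k (l + k + 1)).ncard

/-- `G_l(f) = {T : A(T) = N_f, T ∩ [1,l] = ∅}`. -/
def GSet (l f : ℕ) : Set (Set ℕ) :=
  {T | IsNumericalSet T ∧ AT T = NSet ∅ f ∧ T ∩ Set.Icc 1 l = ∅}

theorem frob_notMem {T : Set ℕ} (hT : IsNumericalSet T) : frob T ∉ T :=
  Nat.sSup_mem hT.2.2 hT.2.1.bddAbove

theorem mem_of_frob_lt {T : Set ℕ} (hT : IsNumericalSet T) {x : ℕ} (hx : frob T < x) : x ∈ T := by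
  by_contra h
  exact absurd (le_csSup hT.2.1.bddAbove (show x ∈ Tᶜ from h)) (not_le.mpr hx)

theorem frob_eq {T : Set ℕ} {f : ℕ} (hf : f ∉ T) (h : ∀ x, f < x → x ∈ T) : frob T = f := by
  refine IsGreatest.csSup_eq ⟨hf, fun x hx => ?_⟩
  by_contra hlt
  exact hx (h x (not_le.mp hlt))

theorem mem_BSet_singleton {T : Set ℕ} {k f : ℕ} :
    T ∈ BSet {k} f ↔ IsNumericalSet T ∧ frob T = f ∧ AT T ∩ Set.Icc (f - k) (f - 1) = {f - k} := by
  simp [BSet]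

theorem mem_NSet_singleton {k f x : ℕ} : x ∈ NSet {k} f ↔ x = 0 ∨ x = f - k ∨ f < x := by
  simp [NSet, or_assoc, or_left_comm]

theorem isNumericalSet_NSet_singleton {k f : ℕ} (hk : 0 < k) (hf : k < f) :
    IsNumericalSet (NSet {k} f) := by
  refine ⟨by simp [mem_NSet_singleton], (Set.finite_Iic f).subset fun x hx => ?_, f, ?_⟩
  · simp only [Set.mem_compl_iff, mem_NSet_singleton] at hx
    simp only [Set.mem_Iic]
    omega
  · simp only [Set.mem_compl_iff, mem_NSet_singleton]
    omega

theorem NSet_singleton_mem_BlSet {l k f : ℕ} (hk : 0 < k) (hf : 2 * k < f) (hlf : l + k < f) :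
    NSet {k} f ∈ BlSet l k f := by
  refine ⟨mem_BSet_singleton.2 ⟨isNumericalSet_NSet_singleton hk (by omega),
    frob_eq ?_ ?_, ?_⟩, ?_⟩
  · rw [mem_NSet_singleton]
    omega
  · intro x hx
    rw [mem_NSet_singleton]
    omega
  · ext x
    simp only [Set.mem_inter_iff, AT, Set.mem_ofPred_eq, mem_NSet_singleton, Set.mem_Icc,
      Set.mem_singleton_iff]
    constructor
    · rintro ⟨h, h₁, h₂⟩
      have := h 0 (Or.inl rfl)
      omega
    · rintro rfl
      refine ⟨fun y hy => ?_, by omega, by omega⟩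
      omega
  · ext x
    simp only [Set.mem_inter_iff, mem_NSet_singleton, Set.mem_Icc, Set.mem_empty_iff_false,
      iff_false]
    omega

theorem eq_NSet_of_mem_BlSet {l k f : ℕ} {T : Set ℕ} (hf : 2 * k < f)
    (hfl : f ≤ l + k + 1 ∨ f = 2 * k + 1 ∧ k ≤ 2 * l + 1) (hT : T ∈ BlSet l k f) :
    T = NSet {k} f := by
  obtain ⟨hB, hl⟩ := hT
  obtain ⟨hN, hfrob, hA⟩ := mem_BSet_singleton.1 hB
  have h0 : 0 ∈ T := hN.1
  have hfT : f ∉ T := hfrob ▸ frob_notMem hN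
  have hbig : ∀ x, f < x → x ∈ T := fun x hx => mem_of_frob_lt hN (hfrob.symm ▸ hx)
  have hlow : ∀ x ∈ T, x = 0 ∨ l < x := fun x hx => by
    by_contra h
    exact (hl ▸ ⟨hx, by omega, by omega⟩ : x ∈ (∅ : Set ℕ))
  have hAk : ∀ x ∈ T, f - k + x ∈ T := by
    have : f - k ∈ AT T ∩ Set.Icc (f - k) (f - 1) := hA ▸ rfl
    exact this.1
  have hgap : ∀ x ∈ T, f - k < x → x < f → ∃ y ∈ T, l < y ∧ x + y ≤ f := by
    intro x hx h₁ h₂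
    have hxA : x ∉ AT T := fun h => by
      have : x ∈ ({f - k} : Set ℕ) := hA ▸ ⟨h, by omega, by omega⟩
      exact h₁.ne' this
    simp only [AT, Set.mem_ofPred_eq, not_forall] at hxA
    obtain ⟨y, hy, hxy⟩ := hxA
    refine ⟨y, hy, (hlow y hy).resolve_left ?_, not_lt.mp fun h => hxy (hbig _ h)⟩
    rintro rfl
    exact hxy hx
  have hmid : ∀ x ∈ T, x = 0 ∨ f - k ≤ x := fun x hx => by
    by_contra h
    have hlx := hlow x hx
    have hne : f - k + x ≠ f := fun h => hfT (h ▸ hAk x hx)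
    obtain ⟨y, -, hly, hy⟩ := hgap _ (hAk x hx) (by omega) (by omega)
    omega
  ext x
  rw [mem_NSet_singleton]
  constructor
  · intro hx
    by_contra h
    have hxf : x ≠ f := fun h => hfT (h ▸ hx)
    have hx' := hmid x hx
    obtain ⟨y, hyT, hly, hy⟩ := hgap x hx (by omega) (by omega)
    have := hmid y hyT
    omega
  · rintro (rfl | rfl | hx)
    · exact h0
    · exact hAk 0 h0
    · exact hbig x hx

theorem stmt10 (l k : ℕ) (hl : 0 < l) (hk : 0 < k) (hkl : k ≤ 2 * l + 1) :
    CConst l k = 1 := by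
  unfold CConst
  split_ifs with h <;> rw [Set.ncard_eq_one]
  · exact ⟨_, Set.eq_singleton_iff_unique_mem.2
      ⟨NSet_singleton_mem_BlSet hk (by omega) (by omega),
        fun T hT => eq_NSet_of_mem_BlSet (by omega) (Or.inr ⟨rfl, hkl⟩) hT⟩⟩
  · exact ⟨_, Set.eq_singleton_iff_unique_mem.2
      ⟨NSet_singleton_mem_BlSet hk (by omega) (by omega),
        fun T hT => eq_NSet_of_mem_BlSet (by omega) (Or.inl le_rfl) hT⟩⟩
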